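/- Suppose that E_k[f] ≥ (sup_k f + inf_k f)/2 pointwise for every k ∈ {1,…,n}, and let A = ‖ Σ_{k=1}^n (sup_k f − E_k[f])·(E_k[f] − inf_k f) ‖_∞. Then for every t > 0, μ{x : f(x) − E[f] > t} ≤ exp( −t² / (2A) ). -/

import Mathlib

open MeasureTheory Real

section ProductSpace

variable {n : ℕ} {Ω : Fin n → Type*} [∀ k, MeasurableSpace (Ω k)]

/-- Thermal expectation `E_{βf}[g] = E[g e^{βf}] / E[e^{βf}]`. -/
noncomputable def thermalExp {α : Type*} [MeasurableSpace α] (ν : Measure α)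
    (β : ℝ) (f g : α → ℝ) : ℝ :=
  (∫ x, g x * Real.exp (β * f x) ∂ν) / ∫ x, Real.exp (β * f x) ∂ν

/-- Canonical entropy `S_f(β) = β E_{βf}[f] − ln Z_{βf}`. -/
noncomputable def canEntropy {α : Type*} [MeasurableSpace α] (ν : Measure α)
    (f : α → ℝ) (β : ℝ) : ℝ :=
  β * thermalExp ν β f f - Real.log (∫ x, Real.exp (β * f x) ∂ν)

/-- Conditional expectation `E_k[g](x) = ∫ g(x_{y,k}) dμ_k(y)`. -/
noncomputable def condExpK (μ : ∀ k, Measure (Ω k)) (k : Fin n)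
    (g : (∀ i, Ω i) → ℝ) (x : ∀ i, Ω i) : ℝ :=
  ∫ y, g (Function.update x k y) ∂(μ k)

/-- Conditional thermal expectation `E_{k,βf}[g](x) = E_k[g e^{βf}](x) / E_k[e^{βf}](x)`. -/
noncomputable def condThermalExpK (μ : ∀ k, Measure (Ω k)) (k : Fin n) (β : ℝ)
    (f g : (∀ i, Ω i) → ℝ) (x : ∀ i, Ω i) : ℝ :=
  (∫ y, g (Function.update x k y) * Real.exp (β * f (Function.update x k y)) ∂(μ k)) /
    ∫ y, Real.exp (β * f (Function.update x k y)) ∂(μ k)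

/-- Conditional entropy `S_{k,f}(β)(x) = β E_{k,βf}[f](x) − ln Z_{k,βf}(x)`. -/
noncomputable def condEntropyK (μ : ∀ k, Measure (Ω k)) (k : Fin n)
    (f : (∀ i, Ω i) → ℝ) (β : ℝ) (x : ∀ i, Ω i) : ℝ :=
  β * condThermalExpK μ k β f f x -
    Real.log (∫ y, Real.exp (β * f (Function.update x k y)) ∂(μ k))

/-- Conditional variance `σ²_k[g](x) = E_k[(g − E_k[g])²](x)`. -/
noncomputable def condVarK (μ : ∀ k, Measure (Ω k)) (k : Fin n)
    (g : (∀ i, Ω i) → ℝ) (x : ∀ i, Ω i) : ℝ :=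
  ∫ y, (g (Function.update x k y) - condExpK μ k g x) ^ 2 ∂(μ k)

/-- Conditional supremum `(sup_k g)(x) = sup_{y} g(x_{y,k})`. -/
noncomputable def condSupK (k : Fin n) (g : (∀ i, Ω i) → ℝ) (x : ∀ i, Ω i) : ℝ :=
  ⨆ y : Ω k, g (Function.update x k y)

/-- Conditional infimum `(inf_k g)(x) = inf_{y} g(x_{y,k})`. -/
noncomputable def condInfK (k : Fin n) (g : (∀ i, Ω i) → ℝ) (x : ∀ i, Ω i) : ℝ :=
  ⨅ y : Ω k, g (Function.update x k y)

/-- Worst-case variance proxy `Dg = Σ_k (g − inf_k g)²`. -/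
noncomputable def Dproxy (g : (∀ i, Ω i) → ℝ) (x : ∀ i, Ω i) : ℝ :=
  ∑ k, (g x - condInfK k g x) ^ 2

end ProductSpace

section Helpers

open ProbabilityTheory

/-- Bounded measurable functions. -/
def BM {α : Type*} [MeasurableSpace α] (g : α → ℝ) : Prop :=
  Measurable g ∧ ∃ C, ∀ x, |g x| ≤ C

lemma BM.integrable {α : Type*} [MeasurableSpace α] {g : α → ℝ} (h : BM g)
    (ν : Measure α) [IsFiniteMeasure ν] : Integrable g ν := by
  obtain ⟨hm, C, hC⟩ := h
  exact Integrable.of_bound hm.aestronglyMeasurable C (ae_of_all _ fun x => by simpa using hC x)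

lemma BM.add {α : Type*} [MeasurableSpace α] {g h : α → ℝ} (hg : BM g) (hh : BM h) :
    BM (fun x => g x + h x) := by
  obtain ⟨hm, C, hC⟩ := hg
  obtain ⟨hm', C', hC'⟩ := hh
  exact ⟨hm.add hm', C + C', fun x => (abs_add_le _ _).trans (add_le_add (hC x) (hC' x))⟩

lemma BM.neg {α : Type*} [MeasurableSpace α] {g : α → ℝ} (hg : BM g) :
    BM (fun x => - g x) := by
  obtain ⟨hm, C, hC⟩ := hg
  exact ⟨hm.neg, C, fun x => by simpa using hC x⟩

lemma BM.sub {α : Type*} [MeasurableSpace α] {g h : α → ℝ} (hg : BM g) (hh : BM h) :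
    BM (fun x => g x - h x) := by
  simpa [sub_eq_add_neg] using hg.add hh.neg

lemma BM.mul {α : Type*} [MeasurableSpace α] {g h : α → ℝ} (hg : BM g) (hh : BM h) :
    BM (fun x => g x * h x) := by
  obtain ⟨hm, C, hC⟩ := hg
  obtain ⟨hm', C', hC'⟩ := hh
  refine ⟨hm.mul hm', C * C', fun x => ?_⟩
  rw [abs_mul]
  exact mul_le_mul (hC x) (hC' x) (abs_nonneg _) ((abs_nonneg _).trans (hC x))

lemma BM.const {α : Type*} [MeasurableSpace α] (c : ℝ) : BM (fun _ : α => c) :=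
  ⟨measurable_const, |c|, fun _ => le_rfl⟩

lemma BM.log {α : Type*} [MeasurableSpace α] {g : α → ℝ} {c : ℝ} (hc : 0 < c)
    (hg : BM g) (h : ∀ x, c ≤ g x) : BM (fun x => Real.log (g x)) := by
  obtain ⟨hm, C, hC⟩ := hg
  refine ⟨Real.measurable_log.comp hm, max (-Real.log c) (Real.log C), fun x => ?_⟩
  have h1 : Real.log c ≤ Real.log (g x) := Real.log_le_log hc (h x)
  have h2 : Real.log (g x) ≤ Real.log C :=
    Real.log_le_log (hc.trans_le (h x)) ((le_abs_self _).trans (hC x))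
  rw [abs_le]
  constructor
  · have := le_max_left (-Real.log c) (Real.log C); linarith
  · exact h2.trans (le_max_right _ _)

lemma BM.exp {α : Type*} [MeasurableSpace α] {g : α → ℝ} (hg : BM g) :
    BM (fun x => Real.exp (g x)) := by
  obtain ⟨hm, C, hC⟩ := hg
  refine ⟨Real.measurable_exp.comp hm, Real.exp C, fun x => ?_⟩
  rw [abs_of_pos (Real.exp_pos _)]
  exact Real.exp_le_exp.2 ((le_abs_self _).trans (hC x))

lemma BM.sum {α ι : Type*} [MeasurableSpace α] (s : Finset ι) {g : ι → α → ℝ}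
    (hg : ∀ i, BM (g i)) : BM (fun x => ∑ i ∈ s, g i x) := by
  classical
  induction s using Finset.induction_on with
  | empty => simpa using BM.const (α := α) 0
  | insert a s ha ih => simpa [Finset.sum_insert ha] using (hg a).add ih

lemma BM.comp {α γ : Type*} [MeasurableSpace α] [MeasurableSpace γ] {g : α → ℝ} (hg : BM g)
    {φ : γ → α} (hφ : Measurable φ) : BM (fun x => g (φ x)) :=
  ⟨hg.1.comp hφ, hg.2.imp fun _ h _ => h _⟩

/-- Gibbs variational inequality. -/
lemma gibbs {α : Type*} [MeasurableSpace α] (ν : Measure α) [IsProbabilityMeasure ν]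
    {u w : α → ℝ} {c d : ℝ} (hc : 0 < c) (hd : 0 < d) (hu : BM u) (hw : BM w)
    (huc : ∀ x, c ≤ u x) (hwd : ∀ x, d ≤ w x) :
    ∫ x, u x * (Real.log (w x) - Real.log (∫ y, w y ∂ν)) ∂ν
      ≤ (∫ x, u x * Real.log (u x) ∂ν) - (∫ x, u x ∂ν) * Real.log (∫ x, u x ∂ν) := by
  set U := ∫ x, u x ∂ν with hU
  set W := ∫ x, w x ∂ν with hW
  have hUpos : 0 < U := by
    have : ∫ _, c ∂ν ≤ U := integral_mono (integrable_const c) (hu.integrable ν) huc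
    simp at this; linarith
  have hWpos : 0 < W := by
    have : ∫ _, d ∂ν ≤ W := integral_mono (integrable_const d) (hw.integrable ν) hwd
    simp at this; linarith
  have key : ∀ x, u x * (Real.log (w x) - Real.log W) ≤
      (u x * Real.log (u x) - u x * Real.log U) + (w x * (U / W) - u x) := by
    intro x
    have hux := hc.trans_le (huc x)
    have hwx := hd.trans_le (hwd x)
    have h := Real.log_le_sub_one_of_pos (x := (w x * U) / (W * u x)) (by positivity)
    rw [Real.log_div (by positivity) (by positivity), Real.log_mul (by positivity) (by positivity),
      Real.log_mul (by positivity) (by positivity)] at h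
    have h2 := mul_le_mul_of_nonneg_left h hux.le
    have h3 : u x * ((w x * U) / (W * u x) - 1) = w x * (U / W) - u x := by
      field_simp
    rw [h3] at h2
    linarith
  have i1 := hu.mul ((hw.log hd hwd).sub (BM.const (Real.log W)))
  have i2 := hu.mul (hu.log hc huc)
  have i3 := hu.mul (BM.const (α := α) (Real.log U))
  have i4 := hw.mul (BM.const (α := α) (U / W))
  refine (integral_mono (i1.integrable ν) (((i2.sub i3).add (i4.sub hu)).integrable ν) key).trans ?_
  rw [integral_add ((i2.sub i3).integrable ν) ((i4.sub hu).integrable ν),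
    integral_sub (i2.integrable ν) (i3.integrable ν), integral_sub (i4.integrable ν)
    (hu.integrable ν), integral_mul_const, integral_mul_const, ← hU, ← hW]
  have : W * (U / W) = U := by field_simp
  rw [this]; linarith

lemma mem_int {α : Type*} [MeasurableSpace α] (ν : Measure α) [IsProbabilityMeasure ν]
    {h : α → ℝ} (hh : BM h) (t : ℝ) : t ∈ interior (integrableExpSet h ν) := by
  have : integrableExpSet h ν = Set.univ := by
    ext s
    simp only [integrableExpSet, Set.mem_ofPred_eq, Set.mem_univ, iff_true]
    exact (((BM.const s).mul hh).exp).integrable ν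
  simp [this]

lemma canEntropy_eq {α : Type*} [MeasurableSpace α] (ν : Measure α) [IsProbabilityMeasure ν]
    {h : α → ℝ} (hh : BM h) (β : ℝ) :
    canEntropy ν h β = β * deriv (cgf h ν) β - cgf h ν β := by
  rw [deriv_cgf (mem_int ν hh β)]
  rfl

/-- One-dimensional bound. -/
lemma entropy_le {α : Type*} [MeasurableSpace α] (ν : Measure α) [IsProbabilityMeasure ν]
    {h : α → ℝ} (hh : BM h) {a b : ℝ} (ha : ∀ x, a ≤ h x) (hb : ∀ x, h x ≤ b)
    (hm : (b + a) / 2 ≤ ∫ x, h x ∂ν) {β : ℝ} (hβ : 0 ≤ β) :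
    0 ≤ canEntropy ν h β ∧
    canEntropy ν h β ≤ β ^ 2 / 2 * ((b - ∫ x, h x ∂ν) * ((∫ x, h x ∂ν) - a)) := by
  set m := ∫ x, h x ∂ν with hm'
  set G := cgf h ν with hG
  have han : ∀ s, AnalyticAt ℝ G s := fun s => analyticAt_cgf (mem_int ν hh s)
  have hd1 : ∀ s, HasDerivAt G (deriv G s) s := fun s => (han s).differentiableAt.hasDerivAt
  have hd2 : ∀ s, HasDerivAt (deriv G) (deriv (deriv G) s) s :=
    fun s => (han s).deriv.differentiableAt.hasDerivAt
  have hvar : ∀ s, deriv (deriv G) s = variance h (ν.tilted (s * h ·)) := by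
    intro s
    rw [variance_tilted_mul (mem_int ν hh s), iteratedDeriv_succ, iteratedDeriv_one]
  have hprob : ∀ s, IsProbabilityMeasure (ν.tilted (s * h ·)) := fun s =>
    isProbabilityMeasure_tilted ((((BM.const s).mul hh).exp).integrable ν)
  have hnn : ∀ s, 0 ≤ deriv (deriv G) s := fun s => by rw [hvar]; exact variance_nonneg _ _
  have hmono : Monotone (deriv G) := monotone_of_deriv_nonneg (fun s => (hd2 s).differentiableAt) hnn
  have h0 : deriv G 0 = m := by
    rw [hG, deriv_cgf_zero (mem_int ν hh 0)]; simp [hm']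
  have hG0 : G 0 = 0 := by simp [hG]
  have hle : ∀ s, 0 ≤ s → deriv (deriv G) s ≤ (b - m) * (m - a) := by
    intro s hs
    have := hprob s
    have h1 := variance_le_sub_mul_sub (μ := ν.tilted (s * h ·)) (X := h) (a := a) (b := b)
      (ae_of_all _ fun x => ⟨ha x, hb x⟩) hh.1.aemeasurable
    rw [← hvar, integral_tilted_mul_self (mem_int ν hh s)] at h1
    have h2 : m ≤ deriv G s := h0 ▸ hmono hs
    refine h1.trans ?_
    change (b - deriv G s) * (deriv G s - a) ≤ _
    nlinarith
  rw [canEntropy_eq ν hh]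
  have hS : ∀ s, HasDerivAt (fun s => s * deriv G s - G s) (s * deriv (deriv G) s) s := by
    intro s
    convert! ((hasDerivAt_id s).mul (hd2 s)).sub (hd1 s) using 1
    simp
  constructor
  · have : MonotoneOn (fun s => s * deriv G s - G s) (Set.Ici 0) := by
      apply monotoneOn_of_deriv_nonneg (convex_Ici 0)
      · exact fun s _ => (hS s).continuousAt.continuousWithinAt
      · exact fun s _ => (hS s).differentiableAt.differentiableWithinAt
      · intro s hs
        rw [(hS s).deriv]
        rw [interior_Ici] at hs
        exact mul_nonneg (le_of_lt hs) (hnn s)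
    have := this (Set.self_mem_Ici) hβ hβ
    simpa [hG0] using this
  · set V := (b - m) * (m - a)
    have hT : ∀ s, HasDerivAt (fun s => (s * deriv G s - G s) - s ^ 2 / 2 * V)
        (s * deriv (deriv G) s - s * V) s := by
      intro s
      convert! (hS s).sub ((((hasDerivAt_id s).pow 2).div_const 2).mul_const V) using 1
      simp
    have : AntitoneOn (fun s => (s * deriv G s - G s) - s ^ 2 / 2 * V) (Set.Ici 0) := by
      apply antitoneOn_of_deriv_nonpos (convex_Ici 0)
      · exact fun s _ => (hT s).continuousAt.continuousWithinAt
      · exact fun s _ => (hT s).differentiableAt.differentiableWithinAt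
      · intro s hs
        rw [(hT s).deriv]
        rw [interior_Ici] at hs
        have := mul_le_mul_of_nonneg_left (hle s (le_of_lt hs)) (le_of_lt hs)
        linarith
    have := this (Set.self_mem_Ici) hβ hβ
    simp [hG0] at this
    linarith

/-- Herbst argument. -/
lemma herbst {α : Type*} [MeasurableSpace α] (ν : Measure α) [IsProbabilityMeasure ν]
    {h : α → ℝ} (hh : BM h) {A : ℝ}
    (hS : ∀ β, 0 < β → canEntropy ν h β ≤ β ^ 2 / 2 * A) {β : ℝ} (hβ : 0 < β) :
    cgf h ν β ≤ β * (∫ x, h x ∂ν) + β ^ 2 / 2 * A := by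
  set m := ∫ x, h x ∂ν with hm'
  set G := cgf h ν with hG
  have han : ∀ s, AnalyticAt ℝ G s := fun s => analyticAt_cgf (mem_int ν hh s)
  have hd1 : ∀ s, HasDerivAt G (deriv G s) s := fun s => (han s).differentiableAt.hasDerivAt
  have h0 : deriv G 0 = m := by
    rw [hG, deriv_cgf_zero (mem_int ν hh 0)]; simp [hm']
  have hG0 : G 0 = 0 := by simp [hG]
  have hder : ∀ s, 0 < s → HasDerivAt (fun s => G s / s - s / 2 * A)
      ((deriv G s * s - G s * 1) / s ^ 2 - 1 / 2 * A) s := by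
    intro s hs
    exact ((hd1 s).div (hasDerivAt_id s) hs.ne').sub (((hasDerivAt_id s).div_const 2).mul_const A)
  have hanti : AntitoneOn (fun s => G s / s - s / 2 * A) (Set.Ioi 0) := by
    apply antitoneOn_of_deriv_nonpos (convex_Ioi 0)
    · exact fun s hs => (hder s hs).continuousAt.continuousWithinAt
    · intro s hs
      rw [interior_Ioi] at hs
      exact (hder s hs).differentiableAt.differentiableWithinAt
    · intro s hs
      rw [interior_Ioi] at hs
      rw [(hder s hs).deriv]
      have h1 := hS s hs
      rw [canEntropy_eq ν hh] at h1
      have hs' : 0 < s := hs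
      rw [sub_nonpos, div_le_iff₀ (by positivity)]
      change s * deriv G s - G s ≤ _ at h1
      linarith
  have hlim : Filter.Tendsto (fun s => G s / s - s / 2 * A) (nhdsWithin 0 (Set.Ioi 0))
      (nhds m) := by
    have h1 := (hasDerivAt_iff_tendsto_slope.1 (hd1 0)).mono_left
      (nhdsWithin_mono 0 (fun x hx => ne_of_gt hx) : nhdsWithin (0:ℝ) (Set.Ioi 0) ≤ _)
    rw [h0] at h1
    have h2 : Filter.Tendsto (fun s : ℝ => s / 2 * A) (nhdsWithin 0 (Set.Ioi 0)) (nhds 0) := by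
      have : Continuous (fun s : ℝ => s / 2 * A) := by fun_prop
      simpa using (this.tendsto 0).mono_left nhdsWithin_le_nhds
    have h3 := h1.sub h2
    rw [sub_zero] at h3
    refine h3.congr fun s => ?_
    simp [slope_def_field, hG0]
  have hle : G β / β - β / 2 * A ≤ m := by
    refine ge_of_tendsto hlim ?_
    have : Set.Ioo (0:ℝ) β ∈ nhdsWithin (0:ℝ) (Set.Ioi 0) := Ioo_mem_nhdsGT hβ
    filter_upwards [this] with s hs
    exact hanti hs.1 hβ hs.2.le
  have : G β / β ≤ m + β / 2 * A := by linarith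
  rw [div_le_iff₀ hβ] at this
  nlinarith

end Helpers

section Tensor

open ProbabilityTheory

variable {n : ℕ} {Ω : Fin n → Type*} [∀ k, MeasurableSpace (Ω k)]

lemma mp_update (μ : ∀ k, Measure (Ω k)) [∀ k, IsProbabilityMeasure (μ k)] (k : Fin n) :
    MeasurePreserving (fun p : (∀ i, Ω i) × Ω k => Function.update p.1 k p.2)
      ((Measure.pi μ).prod (μ k)) (Measure.pi μ) := by
  refine ⟨measurable_update', ?_⟩
  symm
  apply Measure.pi_eq
  intro s hs
  rw [Measure.map_apply measurable_update' (MeasurableSet.univ_pi hs)]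
  have : (fun p : (∀ i, Ω i) × Ω k => Function.update p.1 k p.2) ⁻¹' (Set.pi Set.univ s)
      = (Set.pi Set.univ (Function.update s k Set.univ)) ×ˢ (s k) := by
    ext ⟨x, y⟩
    simp only [Set.mem_preimage, Set.mem_pi, Set.mem_univ, forall_true_left, Set.mem_prod]
    constructor
    · intro h
      refine ⟨fun i => ?_, by simpa using h k⟩
      by_cases hi : i = k
      · subst hi; simp
      · simpa [hi] using h i
    · rintro ⟨h1, h2⟩ i
      by_cases hi : i = k
      · subst hi; simpa using h2
      · simpa [hi] using h1 i
  rw [this, Measure.prod_prod, Measure.pi_pi, ← Finset.mul_prod_erase _ _ (Finset.mem_univ k),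
    ← Finset.mul_prod_erase _ (fun i => μ i (s i)) (Finset.mem_univ k)]
  simp only [Function.update_self, measure_univ, one_mul]
  rw [mul_comm]
  congr 1
  refine Finset.prod_congr rfl fun i hi => ?_
  rw [Function.update_of_ne (Finset.ne_of_mem_erase hi)]

lemma BM.condExpK (μ : ∀ k, Measure (Ω k)) [∀ k, IsProbabilityMeasure (μ k)] (k : Fin n)
    {g : (∀ i, Ω i) → ℝ} (hg : BM g) : BM (condExpK μ k g) := by
  obtain ⟨hm, C, hC⟩ := hg
  refine ⟨?_, C, fun x => ?_⟩
  · have h1 : Measurable (fun p : (∀ i, Ω i) × Ω k => g (Function.update p.1 k p.2)) :=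
      hm.comp measurable_update'
    exact h1.stronglyMeasurable.integral_prod_right'.measurable
  · have := norm_integral_le_of_norm_le_const (μ := μ k)
      (f := fun y => g (Function.update x k y)) (C := C) (ae_of_all _ fun y => hC _)
    simpa [_root_.condExpK] using this

lemma condExpK_ge (μ : ∀ k, Measure (Ω k)) [∀ k, IsProbabilityMeasure (μ k)] (k : Fin n)
    {g : (∀ i, Ω i) → ℝ} (hg : BM g) {c : ℝ} (hc : ∀ x, c ≤ g x) (x) : c ≤ condExpK μ k g x := by
  have : ∫ _, c ∂(μ k) ≤ condExpK μ k g x :=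
    integral_mono (integrable_const c) ((hg.comp (measurable_update x)).integrable (μ k))
      (fun y => hc _)
  simpa using this

lemma integral_condExpK (μ : ∀ k, Measure (Ω k)) [∀ k, IsProbabilityMeasure (μ k)] (k : Fin n)
    {g : (∀ i, Ω i) → ℝ} (hg : BM g) :
    ∫ x, condExpK μ k g x ∂(Measure.pi μ) = ∫ x, g x ∂(Measure.pi μ) := by
  have h := mp_update μ k
  rw [← h.map_eq, integral_map h.measurable.aemeasurable hg.1.aestronglyMeasurable, h.map_eq,
    integral_prod _ ((hg.comp h.measurable).integrable _)]
  rfl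

/-- successive averages -/
noncomputable def gseq (μ : ∀ k, Measure (Ω k)) (g : (∀ i, Ω i) → ℝ) : ℕ → (∀ i, Ω i) → ℝ
  | 0 => g
  | (k + 1) => if h : k < n then condExpK μ ⟨k, h⟩ (gseq μ g k) else gseq μ g k

lemma gseq_succ (μ : ∀ k, Measure (Ω k)) (g : (∀ i, Ω i) → ℝ) (k : Fin n) :
    gseq μ g (k + 1) = condExpK μ k (gseq μ g k) := by
  simp [gseq]

lemma gseq_BM (μ : ∀ k, Measure (Ω k)) [∀ k, IsProbabilityMeasure (μ k)]
    {g : (∀ i, Ω i) → ℝ} (hg : BM g) {c : ℝ} (hc : ∀ x, c ≤ g x) (k : ℕ) :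
    BM (gseq μ g k) ∧ (∀ x, c ≤ gseq μ g k x) ∧
      ∫ x, gseq μ g k x ∂(Measure.pi μ) = ∫ x, g x ∂(Measure.pi μ) := by
  induction k with
  | zero => exact ⟨hg, hc, rfl⟩
  | succ k ih =>
    by_cases h : k < n
    · have e : gseq μ g (k + 1) = condExpK μ ⟨k, h⟩ (gseq μ g k) := gseq_succ μ g ⟨k, h⟩
      rw [e]
      exact ⟨ih.1.condExpK μ _, condExpK_ge μ _ ih.1 ih.2.1,
        (integral_condExpK μ _ ih.1).trans ih.2.2⟩
    · have e : gseq μ g (k + 1) = gseq μ g k := by simp [gseq, h]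
      rw [e]; exact ih

lemma gseq_dep (μ : ∀ k, Measure (Ω k)) (g : (∀ i, Ω i) → ℝ) (k : ℕ) :
    ∀ x x' : ∀ i, Ω i, (∀ i : Fin n, k ≤ i → x i = x' i) → gseq μ g k x = gseq μ g k x' := by
  induction k with
  | zero =>
    intro x x' h
    rw [funext fun i => h i (Nat.zero_le _)]
  | succ k ih =>
    intro x x' h
    by_cases hk : k < n
    · have e : gseq μ g (k + 1) = condExpK μ ⟨k, hk⟩ (gseq μ g k) := gseq_succ μ g ⟨k, hk⟩
      rw [e]
      unfold condExpK
      congr 1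
      ext y
      apply ih
      intro i hi
      by_cases hik : i = ⟨k, hk⟩
      · subst hik; simp
      · rw [Function.update_of_ne hik, Function.update_of_ne hik]
        apply h
        have : (i : ℕ) ≠ k := fun h' => hik (Fin.ext h')
        omega
    · have e : gseq μ g (k + 1) = gseq μ g k := by simp [gseq, hk]
      rw [e]
      apply ih
      intro i hi
      omega

lemma gseq_last (μ : ∀ k, Measure (Ω k)) [∀ k, IsProbabilityMeasure (μ k)]
    {g : (∀ i, Ω i) → ℝ} (hg : BM g) {c : ℝ} (hc : ∀ x, c ≤ g x) (x) :
    gseq μ g n x = ∫ x, g x ∂(Measure.pi μ) := by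
  rw [← (gseq_BM μ hg hc n).2.2]
  have : ∀ x', gseq μ g n x' = gseq μ g n x := fun x' =>
    gseq_dep μ g n x' x fun i hi => absurd i.2 (by omega)
  simp [this]

lemma condEntropyK_eq (μ : ∀ k, Measure (Ω k)) (k : Fin n) (f : (∀ i, Ω i) → ℝ) (β : ℝ) (x) :
    condEntropyK μ k f β x = canEntropy (μ k) (fun y => f (Function.update x k y)) β := rfl

lemma condEntropyK_update (μ : ∀ k, Measure (Ω k)) (k : Fin n) (f : (∀ i, Ω i) → ℝ) (β : ℝ) (x)
    (y : Ω k) : condEntropyK μ k f β (Function.update x k y) = condEntropyK μ k f β x := by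
  simp [condEntropyK_eq]

lemma condExpK_update (μ : ∀ k, Measure (Ω k)) (k : Fin n) (f : (∀ i, Ω i) → ℝ) (x)
    (y : Ω k) : condExpK μ k f (Function.update x k y) = condExpK μ k f x := by
  simp [condExpK]

lemma le_condSupK (k : Fin n) {f : (∀ i, Ω i) → ℝ} {C : ℝ} (hC : ∀ x, |f x| ≤ C) (x) (y : Ω k) :
    f (Function.update x k y) ≤ condSupK k f x :=
  le_ciSup (f := fun y => f (Function.update x k y))
    ⟨C, by rintro _ ⟨y, rfl⟩; exact (le_abs_self _).trans (hC _)⟩ y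

lemma condInfK_le (k : Fin n) {f : (∀ i, Ω i) → ℝ} {C : ℝ} (hC : ∀ x, |f x| ≤ C) (x) (y : Ω k) :
    condInfK k f x ≤ f (Function.update x k y) :=
  ciInf_le (f := fun y => f (Function.update x k y))
    ⟨-C, by rintro _ ⟨y, rfl⟩; exact (abs_le.1 (hC _)).1⟩ y

lemma vk_le (μ : ∀ k, Measure (Ω k)) [∀ k, IsProbabilityMeasure (μ k)] (k : Fin n)
    {f : (∀ i, Ω i) → ℝ} (hf : Measurable f) {C : ℝ} (hC : ∀ x, |f x| ≤ C) (x) :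
    (condSupK k f x - condExpK μ k f x) * (condExpK μ k f x - condInfK k f x)
      ≤ 4 * C ^ 2 := by
  have hne : Nonempty (Ω k) := ⟨x k⟩
  have h1 : condSupK k f x ≤ C := ciSup_le fun y => (le_abs_self _).trans (hC _)
  have h2 : -C ≤ condInfK k f x := le_ciInf fun y => (abs_le.1 (hC _)).1
  have hbm : BM f := ⟨hf, C, hC⟩
  have i1 := (hbm.comp (measurable_update x (a := k))).integrable (μ k)
  have h3 : condExpK μ k f x ≤ condSupK k f x := by
    have : condExpK μ k f x ≤ ∫ _, condSupK k f x ∂(μ k) :=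
      integral_mono i1 (integrable_const _) (fun y => le_condSupK k hC x y)
    simpa [_root_.condExpK] using this
  have h4 : condInfK k f x ≤ condExpK μ k f x := by
    have : ∫ _, condInfK k f x ∂(μ k) ≤ condExpK μ k f x :=
      integral_mono (integrable_const _) i1 (fun y => condInfK_le k hC x y)
    simpa [_root_.condExpK] using this
  nlinarith

lemma condEntropyK_bd (μ : ∀ k, Measure (Ω k)) [∀ k, IsProbabilityMeasure (μ k)] (k : Fin n)
    {f : (∀ i, Ω i) → ℝ} (hf : Measurable f) {C : ℝ} (hC : ∀ x, |f x| ≤ C)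
    (hcoh : ∀ k x, (condSupK k f x + condInfK k f x) / 2 ≤ condExpK μ k f x)
    {β : ℝ} (hβ : 0 ≤ β) (x) :
    0 ≤ condEntropyK μ k f β x ∧ condEntropyK μ k f β x ≤ β ^ 2 / 2 *
      ((condSupK k f x - condExpK μ k f x) * (condExpK μ k f x - condInfK k f x)) := by
  have hbm : BM f := ⟨hf, C, hC⟩
  exact entropy_le (μ k) (hbm.comp (measurable_update x (a := k)))
    (fun y => condInfK_le k hC x y) (fun y => le_condSupK k hC x y) (hcoh k x) hβ

lemma condEntropyK_BM (μ : ∀ k, Measure (Ω k)) [∀ k, IsProbabilityMeasure (μ k)] (k : Fin n)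
    {f : (∀ i, Ω i) → ℝ} (hf : Measurable f) {C : ℝ} (hC : ∀ x, |f x| ≤ C)
    (hcoh : ∀ k x, (condSupK k f x + condInfK k f x) / 2 ≤ condExpK μ k f x)
    {β : ℝ} (hβ : 0 ≤ β) : BM (condEntropyK μ k f β) := by
  have hbm : BM f := ⟨hf, C, hC⟩
  have he := ((BM.const β).mul hbm).exp
  refine ⟨?_, β ^ 2 / 2 * (4 * C ^ 2), fun x => ?_⟩
  · have m1 := ((hbm.mul he).condExpK μ k).1
    have m2 := (he.condExpK μ k).1
    exact ((m1.div m2).const_mul β).sub (Real.measurable_log.comp m2)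
  · have h := condEntropyK_bd μ k hf hC hcoh hβ x
    rw [abs_of_nonneg h.1]
    exact h.2.trans (mul_le_mul_of_nonneg_left (vk_le μ k hf hC x) (by positivity))

/-- one step of the tensorization -/
lemma tensor_step (μ : ∀ k, Measure (Ω k)) [∀ k, IsProbabilityMeasure (μ k)] (k : Fin n)
    {f : (∀ i, Ω i) → ℝ} (hf : BM f) {β : ℝ} (hS : BM (condEntropyK μ k f β))
    {w : (∀ i, Ω i) → ℝ} {c : ℝ} (hc : 0 < c) (hw : BM w) (hwc : ∀ x, c ≤ w x)
    {d : ℝ} (hd : 0 < d) (hud : ∀ x, d ≤ Real.exp (β * f x)) :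
    ∫ x, Real.exp (β * f x) * (Real.log (w x) - Real.log (condExpK μ k w x)) ∂(Measure.pi μ)
      ≤ ∫ x, Real.exp (β * f x) * condEntropyK μ k f β x ∂(Measure.pi μ) := by
  have he := ((BM.const β).mul hf).exp
  have hE := hw.condExpK μ k
  have b1 := he.mul ((hw.log hc hwc).sub (hE.log hc (condExpK_ge μ k hw hwc)))
  have b2 := he.mul hS
  rw [← integral_condExpK μ k b1, ← integral_condExpK μ k b2]
  refine integral_mono ((b1.condExpK μ k).integrable _) ((b2.condExpK μ k).integrable _) ?_
  intro x
  have hu' := he.comp (measurable_update x (a := k))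
  have g := gibbs (μ k) hd hc hu' (hw.comp (measurable_update x (a := k)))
    (fun y => hud _) (fun y => hwc _)
  have e1 : condExpK μ k (fun x => Real.exp (β * f x) *
      (Real.log (w x) - Real.log (condExpK μ k w x))) x = ∫ y, Real.exp (β * f (Function.update x k y))
        * (Real.log (w (Function.update x k y)) -
          Real.log (∫ y, w (Function.update x k y) ∂(μ k))) ∂(μ k) := by
    change ∫ y, _ ∂(μ k) = _
    simp only [condExpK_update]
    rfl
  have e2 : condExpK μ k (fun x => Real.exp (β * f x) * condEntropyK μ k f β x) x =
      (∫ y, Real.exp (β * f (Function.update x k y)) ∂(μ k)) * condEntropyK μ k f β x := by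
    change ∫ y, _ ∂(μ k) = _
    simp only [condEntropyK_update]
    rw [integral_mul_const]
  simp only [e1, e2]
  refine g.trans (le_of_eq ?_)
  have hZ : 0 < ∫ y, Real.exp (β * f (Function.update x k y)) ∂(μ k) :=
    hd.trans_le (condExpK_ge μ k he hud x)
  unfold condEntropyK condThermalExpK
  have e3 : ∫ y, Real.exp (β * f (Function.update x k y)) *
      Real.log (Real.exp (β * f (Function.update x k y))) ∂(μ k) =
      β * ∫ y, f (Function.update x k y) * Real.exp (β * f (Function.update x k y)) ∂(μ k) := by
    rw [← integral_const_mul]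
    congr 1
    ext y
    rw [Real.log_exp]; ring
  rw [e3]
  field_simp

lemma tensor (μ : ∀ k, Measure (Ω k)) [∀ k, IsProbabilityMeasure (μ k)]
    {f : (∀ i, Ω i) → ℝ} (hf : BM f) {β : ℝ} (hS : ∀ k, BM (condEntropyK μ k f β)) {B : ℝ}
    (hB : ∀ᵐ x ∂(Measure.pi μ), ∑ k, condEntropyK μ k f β x ≤ B) :
    canEntropy (Measure.pi μ) f β ≤ B := by
  have he := ((BM.const β).mul hf).exp
  obtain ⟨d, hd, hud⟩ : ∃ d, 0 < d ∧ ∀ x, d ≤ Real.exp (β * f x) := by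
    obtain ⟨_, D, hD⟩ := (BM.const β).mul hf
    exact ⟨Real.exp (-D), Real.exp_pos _, fun x => Real.exp_le_exp.2 (abs_le.1 (hD x)).1⟩
  set u : (∀ i, Ω i) → ℝ := fun x => Real.exp (β * f x) with hu
  set U := ∫ x, u x ∂(Measure.pi μ) with hU
  have hG := gseq_BM μ he hud
  have hUpos : 0 < U := by
    have : ∫ _, d ∂(Measure.pi μ) ≤ U :=
      integral_mono (integrable_const d) (he.integrable _) hud
    simp at this; linarith
  have hlog : ∀ k, BM (fun x => Real.log (gseq μ u k x)) := fun k => (hG k).1.log hd (hG k).2.1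
  have htel : ∀ x, u x * (β * f x - Real.log U) = ∑ k : Fin n,
      u x * (Real.log (gseq μ u k x) - Real.log (gseq μ u (k + 1) x)) := by
    intro x
    rw [← Finset.mul_sum, Fin.sum_univ_eq_sum_range
      (fun k => Real.log (gseq μ u k x) - Real.log (gseq μ u (k + 1) x)) n,
      Finset.sum_range_sub' (fun k => Real.log (gseq μ u k x)), gseq_last μ he hud x]
    simp [gseq, hu, hU]
  have hmain : ∫ x, u x * (β * f x - Real.log U) ∂(Measure.pi μ) ≤ U * B := by
    calc ∫ x, u x * (β * f x - Real.log U) ∂(Measure.pi μ)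
        = ∑ k : Fin n, ∫ x, u x * (Real.log (gseq μ u k x) - Real.log (gseq μ u (k + 1) x))
            ∂(Measure.pi μ) := by
          simp only [htel]
          exact integral_finsetSum _ fun k _ => (he.mul ((hlog k).sub (hlog (k+1)))).integrable _
      _ ≤ ∑ k : Fin n, ∫ x, u x * condEntropyK μ k f β x ∂(Measure.pi μ) := by
          refine Finset.sum_le_sum fun k _ => ?_
          rw [gseq_succ]
          exact tensor_step μ k hf (hS k) hd (hG k).1 (hG k).2.1 hd hud
      _ = ∫ x, u x * ∑ k, condEntropyK μ k f β x ∂(Measure.pi μ) := by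
          simp only [Finset.mul_sum]
          exact (integral_finsetSum _ fun k _ => (he.mul (hS k)).integrable _).symm
      _ ≤ ∫ x, u x * B ∂(Measure.pi μ) := by
          refine integral_mono_ae ((he.mul (BM.sum _ hS)).integrable _)
            ((he.mul (BM.const B)).integrable _) ?_
          filter_upwards [hB] with x hx
          exact mul_le_mul_of_nonneg_left hx (Real.exp_pos _).le
      _ = U * B := by rw [integral_mul_const]
  have hleft : ∫ x, u x * (β * f x - Real.log U) ∂(Measure.pi μ) =
      β * (∫ x, f x * u x ∂(Measure.pi μ)) - U * Real.log U := by
    have : ∀ x, u x * (β * f x - Real.log U) = β * (f x * u x) - u x * Real.log U := by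
      intro x; ring
    simp only [this]
    rw [integral_sub (((BM.const β).mul (hf.mul he)).integrable _)
      ((he.mul (BM.const _)).integrable _), integral_const_mul, integral_mul_const]
  rw [hleft] at hmain
  have : canEntropy (Measure.pi μ) f β = (β * (∫ x, f x * u x ∂(Measure.pi μ)) - U * Real.log U) / U := by
    unfold canEntropy thermalExp
    change β * (_ / U) - Real.log U = _
    field_simp
    rfl
  rw [this, div_le_iff₀ hUpos]
  linarith

end Tensor

section Statements

variable {n : ℕ} {Ω : Fin n → Type*} [∀ k, MeasurableSpace (Ω k)]

/-- Concentration for functions with large conditional expectations. -/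
theorem stmt_13 (μ : ∀ k, Measure (Ω k)) [∀ k, IsProbabilityMeasure (μ k)]
    (f : (∀ i, Ω i) → ℝ) (hf : Measurable f) (C : ℝ) (hC : ∀ x, |f x| ≤ C)
    (hcoh : ∀ k x, (condSupK k f x + condInfK k f x) / 2 ≤ condExpK μ k f x)
    (A : ℝ)
    (hA : A = essSup (fun x => ∑ k,
        (condSupK k f x - condExpK μ k f x) * (condExpK μ k f x - condInfK k f x))
        (Measure.pi μ))
    (t : ℝ) (ht : 0 < t) :
    ((Measure.pi μ) {x | f x - ∫ y, f y ∂(Measure.pi μ) > t}).toReal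
      ≤ Real.exp (-t ^ 2 / (2 * A)) := by
  have hbm : BM f := ⟨hf, C, hC⟩
  rcases le_or_gt A 0 with hA0 | hA0
  · refine (ENNReal.toReal_le_of_le_ofReal zero_le_one (by simpa using prob_le_one)).trans ?_
    refine Real.one_le_exp ?_
    exact div_nonneg_of_nonpos (by nlinarith) (by linarith)
  have hae : ∀ᵐ x ∂(Measure.pi μ), ∑ k,
      (condSupK k f x - condExpK μ k f x) * (condExpK μ k f x - condInfK k f x) ≤ A := by
    rw [hA]
    refine ae_le_essSup ?_
    refine Filter.isBoundedUnder_of ⟨∑ _k : Fin n, 4 * C ^ 2, fun x => ?_⟩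
    exact Finset.sum_le_sum fun k _ => vk_le μ k hf hC x
  have hS : ∀ β, 0 < β → canEntropy (Measure.pi μ) f β ≤ β ^ 2 / 2 * A := by
    intro β hβ
    refine tensor μ hbm (fun k => condEntropyK_BM μ k hf hC hcoh hβ.le) ?_
    filter_upwards [hae] with x hx
    calc ∑ k, condEntropyK μ k f β x
        ≤ ∑ k, β ^ 2 / 2 *
          ((condSupK k f x - condExpK μ k f x) * (condExpK μ k f x - condInfK k f x)) :=
          Finset.sum_le_sum fun k _ => (condEntropyK_bd μ k hf hC hcoh hβ.le x).2
      _ ≤ β ^ 2 / 2 * A := by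
          rw [← Finset.mul_sum]
          exact mul_le_mul_of_nonneg_left hx (by positivity)
  have hβ : 0 < t / A := div_pos ht hA0
  have h1 := herbst (Measure.pi μ) hbm hS hβ
  have h2 := ProbabilityTheory.measure_ge_le_exp_cgf (μ := Measure.pi μ) (X := f)
    ((∫ y, f y ∂(Measure.pi μ)) + t) hβ.le ((((BM.const (t / A)).mul hbm).exp).integrable _)
  have h3 : ((Measure.pi μ) {x | f x - ∫ y, f y ∂(Measure.pi μ) > t}).toReal ≤
      (Measure.pi μ).real {x | (∫ y, f y ∂(Measure.pi μ)) + t ≤ f x} := by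
    refine measureReal_mono ?_
    intro x hx
    have hx' : f x - ∫ y, f y ∂(Measure.pi μ) > t := hx
    change (∫ y, f y ∂(Measure.pi μ)) + t ≤ f x
    linarith
  refine h3.trans (h2.trans (Real.exp_le_exp.2 ?_))
  have h4 : -t ^ 2 / (2 * A) = -(t / A) * t + (t / A) ^ 2 / 2 * A := by
    field_simp
    ring
  rw [h4]
  linarith

end Statements
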